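/- Let p be an odd prime, n an even positive integer, s a positive integer with s ≤ n/2, and ε ∈ {1,−1}. Let {A_i : i ∈ V_s} be a partition of V_n into nonempty sets and let F : V_n → V_s be the function with F(x) = i if and only if x ∈ A_i. Assume the partition is a bent partition satisfying Condition C with sign ε, i.e.: (a) a•A_i = A_i for every a ∈ (ZMod p)ˣ and every i ∈ V_s; and (b) for every g : V_s → ZMod p each of whose fibers has exactly p^{s−1} elements, the composite f = g ∘ F is weakly regular bent with sign ε. Then F is a vectorial dual-bent function satisfying Condition A with sign ε. -/

import Mathlib

open Finset

/-- `ζ_p^t = exp(2πi·t.val/p)` for `t : ZMod p`. -/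
noncomputable def zetaP (p : ℕ) (t : ZMod p) : ℂ :=
  Complex.exp (2 * Real.pi * Complex.I * (t.val : ℂ) / (p : ℂ))

/-- The standard inner product on `V_n = Fin n → ZMod p`. -/
def ip {p n : ℕ} (a x : Fin n → ZMod p) : ZMod p := ∑ i, a i * x i

/-- The Walsh transform of `f : V_n → ZMod p`. -/
noncomputable def walsh {p n : ℕ} [NeZero p] (f : (Fin n → ZMod p) → ZMod p)
    (a : Fin n → ZMod p) : ℂ :=
  ∑ x : Fin n → ZMod p, zetaP p (f x - ip a x)

/-- `f : V_n → ZMod p` is weakly regular bent with sign `ε`. -/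
def WeaklyRegularBent {n : ℕ} (p : ℕ) [NeZero p]
    (f : (Fin n → ZMod p) → ZMod p) (ε : ℤ) : Prop :=
  ∃ fd : (Fin n → ZMod p) → ZMod p,
    ∀ a : Fin n → ZMod p, walsh f a = (ε : ℂ) * (p : ℂ) ^ (n / 2) * zetaP p (fd a)

/-- `F : V_n → V_s` is a vectorial dual-bent function satisfying Condition A with sign `ε`. -/
def ConditionA {n s : ℕ} (p : ℕ) [NeZero p]
    (F : (Fin n → ZMod p) → (Fin s → ZMod p)) (ε : ℤ) : Prop :=
  ∃ Fd : (Fin n → ZMod p) → (Fin s → ZMod p),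
    ∀ c : Fin s → ZMod p, c ≠ 0 → ∀ a : Fin n → ZMod p,
      walsh (fun x => ip c (F x)) a = (ε : ℂ) * (p : ℂ) ^ (n / 2) * zetaP p (ip c (Fd a))

open ZMod (stdAddChar)

theorem zetaP_eq_stdAddChar {p : ℕ} [NeZero p] (t : ZMod p) : zetaP p t = stdAddChar t := by
  rw [ZMod.stdAddChar_apply, ZMod.toCircle_apply, zetaP]

/-- The only rational linear relations among the `p`-th roots of unity are the multiples of
`∑ ζ = 0`. -/
theorem eq_of_sum_mul_stdAddChar_eq_zero {p : ℕ} [Fact p.Prime] (r : ZMod p → ℚ)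
    (h : ∑ j, (r j : ℂ) * stdAddChar j = 0) (j k : ZMod p) : r j = r k := by
  have hp : p.Prime := Fact.out
  have hprim := Complex.isPrimitiveRoot_exp p hp.ne_zero
  set ζ := Complex.exp (2 * Real.pi * Complex.I / p) with hζ
  have hpow (t : ZMod p) : stdAddChar t = ζ ^ t.val := by
    rw [← zetaP_eq_stdAddChar, zetaP, hζ, ← Complex.exp_nat_mul]
    congr 1
    ring
  have hsum : ∑ t : ZMod p, (stdAddChar t : ℂ) = 0 :=
    AddChar.sum_eq_zero_of_ne_one fun h1 ↦ by
      have := ZMod.injective_stdAddChar (N := p) (a₁ := 1) (a₂ := 0) (by rw [h1]; simp)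
      exact one_ne_zero this
  have hval (t : ZMod p) : t.val = p - 1 → t = -1 := by
    intro ht
    rw [← ZMod.natCast_zmod_val t, ht, Nat.cast_sub hp.one_le]
    simp
  suffices key : ∀ t, r t = r (-1) by rw [key j, key k]
  let P : Polynomial ℚ := ∑ t : ZMod p, Polynomial.monomial t.val (r t - r (-1))
  have hcoeff (t : ZMod p) : P.coeff t.val = r t - r (-1) := by
    simp [P, Polynomial.finsetSum_coeff, Polynomial.coeff_monomial,
      (ZMod.val_injective p).eq_iff]
  have hroot : Polynomial.aeval ζ P = 0 := by
    simp only [P, map_sum, Polynomial.aeval_monomial, ← hpow]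
    simp [sub_mul, Finset.sum_sub_distrib, h, ← Finset.mul_sum, hsum]
  have hP : P = 0 := by
    by_contra hne
    have hle := minpoly.degree_le_of_ne_zero ℚ ζ hne hroot
    rw [← Polynomial.cyclotomic_eq_minpoly_rat hprim hp.pos, Polynomial.degree_cyclotomic,
      Nat.totient_prime hp] at hle
    refine hle.not_gt ((Polynomial.degree_lt_iff_coeff_zero _ _).2 fun m hm ↦ ?_)
    rw [Polynomial.finsetSum_coeff]
    refine Finset.sum_eq_zero fun t _ ↦ ?_
    rw [Polynomial.coeff_monomial]
    split_ifs with htm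
    · rw [hval t (by have := t.val_lt; omega), sub_self]
    · rfl
  intro t
  have := hcoeff t
  rw [hP, Polynomial.coeff_zero] at this
  linarith

/-- Swapping two arguments of a colouring changes its block sums in the expected way. -/
theorem sum_filter_comp_swap {ι κ : Type*} [Fintype ι] [DecidableEq ι] [DecidableEq κ]
    (S : ι → ℚ) (g : ι → κ) (i i' : ι) (j : κ) :
    ∑ k with g (Equiv.swap i i' k) = j, S k = ∑ k with g k = j, S k +
      (S i' - S i) * ((if g i = j then 1 else 0) - (if g i' = j then 1 else 0)) := by
  have h1 : ∑ k with g (Equiv.swap i i' k) = j, S k =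
      ∑ k with g k = j, S (Equiv.swap i i' k) := by
    simp only [Finset.sum_filter]
    exact Fintype.sum_equiv (Equiv.swap i i') _ _ fun k ↦ by simp
  have h2 (k : ι) : S (Equiv.swap i i' k) = S k +
      (S i' - S i) * ((if k = i then 1 else 0) - (if k = i' then 1 else 0)) := by
    rw [Equiv.swap_apply_def]
    split_ifs <;> simp_all
  simp only [h1, h2, Finset.sum_add_distrib, ← Finset.mul_sum, Finset.sum_sub_distrib]
  simp [Finset.sum_ite_eq']

/-- If every balanced colouring has exactly one heavy block, then there is exactly one heavy
point. -/
theorem exists_heavy_point {ι κ : Type*} [Fintype ι] [DecidableEq ι] [Fintype κ] [DecidableEq κ]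
    (hκ : 3 ≤ Fintype.card κ) (S : ι → ℚ) {c D : ℚ} (hD : D ≠ 0) {m : ℕ} (hm : 0 < m)
    (g : ι → κ) (hg : ∀ j, (univ.filter fun i => g i = j).card = m)
    (h : ∀ f : ι → κ, (∀ j, (univ.filter fun i => f i = j).card = m) →
      ∃ j₀, ∀ j, ∑ i with f i = j, S i = c + if j = j₀ then D else 0) :
    ∃ i₀ u, ∀ i, S i = u + if i = i₀ then D else 0 := by
  have hswap (i i' : ι) (j : κ) :
      (univ.filter fun k => g (Equiv.swap i i' k) = j).card = m := by
    rw [← hg j]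
    exact Finset.card_equiv (Equiv.swap i i') (by simp)
  have hsurj (j : κ) : ∃ i, g i = j := by
    obtain ⟨i, hi⟩ := Finset.card_pos.1 ((hg j).symm ▸ hm)
    exact ⟨i, (Finset.mem_filter.1 hi).2⟩
  obtain ⟨j₀, hj₀⟩ := h g hg
  have hlight_ne {i i' : ι} (hi : g i ≠ j₀) (hi' : g i' ≠ j₀) (hne : g i ≠ g i') :
      S i = S i' := by
    obtain ⟨j₁, hj₁⟩ := h _ (hswap i i')
    have e₀ := hj₁ j₀
    have e₁ := hj₁ (g i)
    rw [sum_filter_comp_swap, hj₀] at e₀ e₁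
    obtain rfl : j₀ = j₁ := by
      by_contra hj
      simp [hi, hi', hj, hD] at e₀
    simp [hi, hne.symm] at e₁
    linarith
  obtain ⟨j₁, hj₁⟩ : ∃ j₁, j₁ ≠ j₀ :=
    Fintype.exists_ne_of_one_lt_card (by omega) j₀
  obtain ⟨l, rfl⟩ := hsurj j₁
  have hlight {i : ι} (hi : g i ≠ j₀) : S i = S l := by
    by_cases hne : g i = g l
    · obtain ⟨j₂, hj₂⟩ : ∃ j₂, j₂ ∉ ({j₀, g l} : Finset κ) := by
        by_contra! hall
        have := Finset.card_le_card (fun x _ ↦ hall x : univ ⊆ ({j₀, g l} : Finset κ))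
        have := Finset.card_le_two (a := j₀) (b := g l)
        rw [Finset.card_univ] at *
        omega
      obtain ⟨k, rfl⟩ := hsurj j₂
      simp only [Finset.mem_insert, Finset.mem_singleton, not_or] at hj₂
      rw [hlight_ne hi hj₂.1 (hne ▸ Ne.symm hj₂.2), hlight_ne hj₂.1 hj₁ hj₂.2]
    · exact hlight_ne hi hj₁ hne
  have hheavy {i : ι} (hi : g i = j₀) : S i = S l ∨ S i = S l + D := by
    obtain ⟨j₂, hj₂⟩ := h _ (hswap i l)
    have e₀ := hj₂ j₀
    rw [sum_filter_comp_swap, hj₀] at e₀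
    by_cases hj : j₀ = j₂
    · left
      subst hj
      simp [hi, hj₁] at e₀
      linarith
    · right
      simp [hi, hj₁, hj] at e₀
      linarith
  have hmem {i : ι} (hi : S i = S l + D) : g i = j₀ := by
    by_contra hne
    exact hD (by linarith [hlight hne])
  have hval (i : ι) : S i = S l + if S i = S l + D then D else 0 := by
    split_ifs with hi
    · exact hi
    · rw [add_zero]
      by_cases hj : g i = j₀
      · exact (hheavy hj).resolve_right hi
      · exact hlight hj
  have hlsum : m * S l = c := by
    have := hj₀ (g l)
    rw [Finset.sum_congr rfl fun i hi ↦ hlight ((Finset.mem_filter.1 hi).2 ▸ hj₁)] at this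
    simpa [hg, hj₁] using this
  have hcard : (univ.filter fun i => S i = S l + D).card = 1 := by
    have := hj₀ j₀
    rw [Finset.sum_congr rfl fun i _ ↦ hval i, Finset.sum_add_distrib, Finset.sum_const, hg,
      nsmul_eq_mul, hlsum, ← Finset.sum_filter, Finset.sum_const, Finset.filter_filter,
      Finset.filter_congr (q := fun i => S i = S l + D)
        (fun i _ ↦ ⟨And.right, fun hi ↦ ⟨hmem hi, hi⟩⟩),
      nsmul_eq_mul, if_pos rfl] at this
    have := mul_right_cancel₀ hD ((add_left_cancel this).trans (one_mul D).symm)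
    exact_mod_cast this
  obtain ⟨i₀, hi₀⟩ := Finset.card_eq_one.1 hcard
  refine ⟨i₀, S l, fun i ↦ ?_⟩
  have : S i = S l + D ↔ i = i₀ := by
    simpa using Finset.ext_iff.1 hi₀ i
  simpa only [this] using hval i

/-- Exponential sums over sets invariant under nonzero scalars are rational. -/
theorem exists_rat_sum_stdAddChar {p n : ℕ} [Fact p.Prime] (B : Finset (Fin n → ZMod p))
    (hB : ∀ t : ZMod p, t ≠ 0 → ∀ x, t • x ∈ B ↔ x ∈ B) (a : Fin n → ZMod p) :
    ∃ r : ℚ, ∑ x ∈ B, stdAddChar (-ip a x) = (r : ℂ) := by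
  have hp : p.Prime := Fact.out
  set T : ℂ := ∑ x ∈ B, stdAddChar (-ip a x) with hT
  have hscale (t : ZMod p) (ht : t ≠ 0) : ∑ x ∈ B, stdAddChar (t * -ip a x) = T := by
    rw [hT]
    refine Finset.sum_equiv (Equiv.smulRight (β := Fin n → ZMod p) ht) (fun x ↦ ?_) fun x _ ↦ ?_
    · exact (hB t ht x).symm
    · congr 1
      simp only [ip, Equiv.smulRight_apply, Pi.smul_apply, smul_eq_mul, mul_neg, Finset.mul_sum]
      congr 1
      exact Finset.sum_congr rfl fun i _ ↦ by ring
  have h1 : ∑ t : ZMod p, ∑ x ∈ B, stdAddChar (t * -ip a x) = B.card + (p - 1) * T := by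
    rw [← Finset.add_sum_erase _ _ (Finset.mem_univ 0),
      Finset.sum_congr rfl fun t ht ↦ hscale t (Finset.ne_of_mem_erase ht)]
    simp [Finset.card_erase_of_mem, ZMod.card, Nat.cast_sub hp.one_le]
  have h2 : ∑ t : ZMod p, ∑ x ∈ B, stdAddChar (t * -ip a x) =
      (p * (B.filter fun x => ip a x = 0).card : ℂ) := by
    rw [Finset.sum_comm]
    simp only [AddChar.sum_mulShift _ (ZMod.isPrimitive_stdAddChar p), neg_eq_zero, ZMod.card]
    push_cast
    rw [← Finset.sum_filter]
    simp [mul_comm]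
  have hp1 : (p - 1 : ℂ) ≠ 0 := sub_ne_zero.2 (by exact_mod_cast hp.one_lt.ne')
  refine ⟨(p * (B.filter fun x => ip a x = 0).card - B.card) / (p - 1), ?_⟩
  push_cast
  rw [eq_div_iff hp1]
  linear_combination h2 - h1

theorem sum_stdAddChar_ip_eq_zero {p s : ℕ} [NeZero p] {c : Fin s → ZMod p} (hc : c ≠ 0) :
    ∑ i : Fin s → ZMod p, stdAddChar (ip c i) = 0 := by
  obtain ⟨k, hk⟩ := Function.ne_iff.1 hc
  let φ : (Fin s → ZMod p) →+ ZMod p :=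
    { toFun := ip c
      map_zero' := by simp [ip]
      map_add' := fun x y ↦ by simp [ip, mul_add, Finset.sum_add_distrib] }
  refine AddChar.sum_eq_zero_of_ne_one (ψ := stdAddChar.compAddMonoidHom φ) fun h1 ↦ hk ?_
  have := DFunLike.congr_fun h1 (Pi.single k 1)
  rw [AddChar.compAddMonoidHom_apply, AddChar.one_apply,
    ← AddChar.map_zero_eq_one (stdAddChar (N := p))] at this
  have hφ : ip c (Pi.single k 1) = 0 := ZMod.injective_stdAddChar this
  simpa [ip, Pi.single_apply] using hφ

theorem walsh_comp_eq_sum {p n : ℕ} [NeZero p] {ι : Type*} [Fintype ι] [DecidableEq ι]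
    (F : (Fin n → ZMod p) → ι) (g : ι → ZMod p) (a : Fin n → ZMod p) :
    walsh (fun x => g (F x)) a =
      ∑ i, (∑ x with F x = i, stdAddChar (-ip a x)) * stdAddChar (g i) := by
  rw [walsh, ← Finset.sum_fiberwise univ F]
  refine Finset.sum_congr rfl fun i _ ↦ ?_
  rw [Finset.sum_mul]
  refine Finset.sum_congr rfl fun x hx ↦ ?_
  rw [zetaP_eq_stdAddChar, (Finset.mem_filter.1 hx).2, ← AddChar.map_add_eq_mul, neg_add_eq_sub]

theorem stmt8 (p : ℕ) [Fact p.Prime] (hodd : Odd p) (n s : ℕ) (hn : 0 < n) (hneven : Even n)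
    (hs : 0 < s) (hsn : s ≤ n / 2) (ε : ℤ) (hε : ε = 1 ∨ ε = -1)
    -- a partition of `V_n` into nonempty sets `A i`, with `F x = i ↔ x ∈ A i`
    (A : (Fin s → ZMod p) → Set (Fin n → ZMod p))
    (hA : ∀ i, (A i).Nonempty)
    (F : (Fin n → ZMod p) → (Fin s → ZMod p))
    (hFA : ∀ x i, F x = i ↔ x ∈ A i)
    -- Condition C (a): each `A i` is invariant under multiplication by nonzero scalars
    (hinv : ∀ (a : (ZMod p)ˣ) (i : Fin s → ZMod p),
      (fun x => (a : ZMod p) • x) '' A i = A i)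
    -- Condition C (b): every balanced combination of the parts is weakly regular bent with sign ε
    (hbent : ∀ g : (Fin s → ZMod p) → ZMod p,
      (∀ j : ZMod p, (Finset.univ.filter (fun i => g i = j)).card = p ^ (s - 1)) →
      WeaklyRegularBent p (fun x => g (F x)) ε) :
    ConditionA p F ε := by
  have hp : p.Prime := Fact.out
  have hp3 : 3 ≤ p := by
    have := hp.two_le
    have : p ≠ 2 := by rintro rfl; exact absurd hodd (by decide)
    omega
  have hFsmul (t : ZMod p) (ht : t ≠ 0) (x : Fin n → ZMod p) : F (t • x) = F x := by
    rw [hFA, ← hinv (Units.mk0 t ht)]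
    exact ⟨x, (hFA x _).1 rfl, rfl⟩
  set D : ℚ := ε * p ^ (n / 2) with hDdef
  have hDC : (D : ℂ) = (ε : ℂ) * (p : ℂ) ^ (n / 2) := by rw [hDdef]; push_cast; rfl
  have hD : D ≠ 0 := by
    refine mul_ne_zero ?_ (pow_ne_zero _ (by exact_mod_cast hp.ne_zero))
    rcases hε with rfl | rfl <;> norm_num
  have hcoord (j : ZMod p) :
      (univ.filter fun i : Fin s → ZMod p => i ⟨0, hs⟩ = j).card = p ^ (s - 1) := by
    have := Fintype.card_filter_piFinset_const (univ : Finset (ZMod p)) (⟨0, hs⟩ : Fin s) j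
    simpa [ZMod.card] using this
  suffices key : ∀ a, ∃ i₀ : Fin s → ZMod p, ∀ c : Fin s → ZMod p, c ≠ 0 →
      walsh (fun x => ip c (F x)) a = (ε : ℂ) * (p : ℂ) ^ (n / 2) * zetaP p (ip c i₀) by
    choose Fd hFd using key
    exact ⟨Fd, fun c hc a ↦ hFd a c hc⟩
  intro a
  choose S hS using fun i ↦ exists_rat_sum_stdAddChar (univ.filter fun x => F x = i)
    (fun t ht x ↦ by simp [hFsmul t ht]) a
  obtain ⟨i₀, u, hu⟩ := exists_heavy_point (c := (∑ i, S i - D) / p) (by rwa [ZMod.card]) S hD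
    (pow_pos hp.pos (s - 1)) (fun i => i ⟨0, hs⟩) hcoord fun g hg ↦ by
      obtain ⟨gd, hgd⟩ := hbent g hg
      refine ⟨gd a, fun j ↦ ?_⟩
      let r : ZMod p → ℚ := fun j ↦ ∑ i with g i = j, S i - if j = gd a then D else 0
      have hr : ∑ j, (r j : ℂ) * stdAddChar j = 0 := by
        have hw := hgd a
        rw [walsh_comp_eq_sum, ← Finset.sum_fiberwise univ g, zetaP_eq_stdAddChar, ← hDC] at hw
        simp only [r, Rat.cast_sub, sub_mul, Finset.sum_sub_distrib]
        rw [sub_eq_zero]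
        refine Eq.trans ?_ (hw.trans ?_)
        · refine Finset.sum_congr rfl fun j _ ↦ ?_
          rw [Rat.cast_sum, Finset.sum_mul]
          exact Finset.sum_congr rfl fun i hi ↦ by rw [hS, (Finset.mem_filter.1 hi).2]
        · simp [apply_ite, ite_mul]
      have hconst := eq_of_sum_mul_stdAddChar_eq_zero r hr
      have htotal : p * r j = ∑ i, S i - D := by
        calc p * r j = ∑ k, r k := by simp [hconst _ j, ZMod.card]
          _ = ∑ i, S i - D := by
            simp [r, Finset.sum_sub_distrib, Finset.sum_fiberwise]
      rw [← sub_eq_iff_eq_add, eq_div_iff (by exact_mod_cast hp.ne_zero), mul_comm]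
      exact htotal
  refine ⟨i₀, fun c hc ↦ ?_⟩
  rw [walsh_comp_eq_sum F (ip c), zetaP_eq_stdAddChar, ← hDC]
  simp only [hS, hu, Rat.cast_add, add_mul, Finset.sum_add_distrib]
  rw [← Finset.mul_sum, sum_stdAddChar_ip_eq_zero hc]
  simp [apply_ite, ite_mul]
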